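/- arXiv:2306.17556 — 2 statements merged into one kernel-verified Lean document; each statement's English description precedes it below -/
import Mathlib

section
/- For every integer t ≥ 7, the polynomial h(x;t) = x⁴ − t·x³ − 3x² + t·x + 1 is irreducible over ℚ. -/
open Polynomial

/-- The coefficient equations for `(x² + a x + b) (x² + c x + d) = x⁴ − t x³ − 3 x² + t x + 1`
force `t = 0`. -/
theorem eq_zero_of_quadratic_factorization {a b c d t : ℤ} (h₀ : b * d = 1)
    (h₁ : a * d + b * c = t) (h₂ : b + a * c + d = -3) (h₃ : a + c = -t) : t = 0 := by
  rcases Int.mul_eq_one_iff_eq_one_or_neg_one.mp h₀ with ⟨rfl, rfl⟩ | ⟨rfl, rfl⟩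
  · linarith
  · have hac : a * -c = 1 := by linarith
    rcases Int.mul_eq_one_iff_eq_one_or_neg_one.mp hac with ⟨_, _⟩ | ⟨_, _⟩ <;> linarith

/-- The quartic has no integral root. -/
theorem quartic_ne_zero (t r : ℤ) : r ^ 4 - t * r ^ 3 - 3 * r ^ 2 + t * r + 1 ≠ 0 := by
  intro h
  have hr : r * -(r ^ 3 - t * r ^ 2 - 3 * r + t) = 1 := by linear_combination -h
  rcases Int.mul_eq_one_iff_eq_one_or_neg_one.mp hr with ⟨rfl, _⟩ | ⟨rfl, _⟩ <;>
    ring_nf at h <;> omega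

theorem monic_quartic (t : ℤ) :
    (X ^ 4 - C t * X ^ 3 - 3 * X ^ 2 + C t * X + 1 : ℤ[X]).Monic := by
  change (X ^ 4 - C t * X ^ 3 - C 3 * X ^ 2 + C t * X + 1 : ℤ[X]).Monic
  monicity!

theorem natDegree_quartic (t : ℤ) :
    (X ^ 4 - C t * X ^ 3 - 3 * X ^ 2 + C t * X + 1 : ℤ[X]).natDegree = 4 := by
  change (X ^ 4 - C t * X ^ 3 - C 3 * X ^ 2 + C t * X + 1 : ℤ[X]).natDegree = 4
  compute_degree!

theorem Polynomial.Monic.eq_X_sq_add {R : Type*} [Semiring R] {f : R[X]} (hf : f.Monic)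
    (h : f.natDegree = 2) : f = X ^ 2 + C (f.coeff 1) * X + C (f.coeff 0) := by
  have := hf.as_sum
  rw [h] at this
  simp only [Finset.sum_range_succ, Finset.sum_range_zero] at this
  conv_lhs => rw [this]
  simp [add_comm, add_left_comm]

theorem irreducible_quartic_int {t : ℤ} (ht : t ≠ 0) :
    Irreducible (X ^ 4 - C t * X ^ 3 - 3 * X ^ 2 + C t * X + 1 : ℤ[X]) := by
  have hm := monic_quartic t
  have hd := natDegree_quartic t
  rw [hm.irreducible_iff_natDegree']
  refine ⟨fun h => by rw [h, natDegree_one] at hd; omega, fun f g hf hg hfg hmem => ?_⟩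
  have hdeg := hf.natDegree_mul hg
  rw [hfg, hd] at hdeg
  rw [hd, Finset.mem_Ioc] at hmem
  obtain hg₁ | hg₂ : g.natDegree = 1 ∨ g.natDegree = 2 := by omega
  · have hroot : g.eval (-g.coeff 0) = 0 := by
      rw [hg.eq_X_add_C hg₁]
      simp
    have := congrArg (eval (-g.coeff 0)) hfg
    rw [eval_mul, hroot, mul_zero] at this
    apply quartic_ne_zero t (-g.coeff 0)
    simpa using this.symm
  · have hf' := hf.eq_X_sq_add (by omega)
    have hg' := hg.eq_X_sq_add hg₂
    generalize f.coeff 1 = a at hf'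
    generalize f.coeff 0 = b at hf'
    generalize g.coeff 1 = c at hg'
    generalize g.coeff 0 = d at hg'
    have key : C (b * d) + C (a * d + b * c) * X + C (b + a * c + d) * X ^ 2 +
        C (a + c) * X ^ 3 = (1 + C t * X + C (-3) * X ^ 2 + C (-t) * X ^ 3 : ℤ[X]) := by
      rw [hf', hg'] at hfg
      simp only [map_add, map_mul, map_neg, map_ofNat]
      linear_combination hfg
    have hcoeff (n : ℕ) := congrArg (coeff · n) key
    simp only [coeff_add, coeff_C_mul, coeff_C, coeff_X, coeff_X_pow, coeff_one] at hcoeff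
    exact ht (eq_zero_of_quadratic_factorization (by simpa using hcoeff 0)
      (by simpa using hcoeff 1) (by simpa using hcoeff 2) (by simpa using hcoeff 3))

/-- For every integer `t ≥ 7`, the polynomial `h(x;t) = x⁴ − t·x³ − 3x² + t·x + 1`
is irreducible over `ℚ`. -/
theorem stmt_9 (t : ℤ) (ht : 7 ≤ t) :
    Irreducible (X ^ 4 - C (t : ℚ) * X ^ 3 - 3 * X ^ 2 + C (t : ℚ) * X + 1 : Polynomial ℚ) := by
  have h := ((monic_quartic t).irreducible_iff_irreducible_map_fraction_map (K := ℚ)).mp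
    (irreducible_quartic_int (by omega))
  simpa using h
end

section
/- For all integers n ≥ 4 and t ≥ 4, any root α of g_n(x;t) = xⁿ − (t+3)·x^{n−1} + t·x + 1 is an exceptional unit of the degree-n number field ℚ(α): both α and 1 − α are units in the ring of integers of ℚ(α). Hence for every n ≥ 4 there exist infinitely many exceptional number fields of degree n. -/
open Polynomial NumberField

/-- If `w` is the dominant root of the trinomial, then the quotient of the trinomial by `X - w`
has all its roots in the open unit disc. -/
theorem cofactor_ne_zero {m : ℕ} {t w : ℝ} (ht : 0 ≤ t) (hw : t + 2 < w)
    (hroot : (t + 3 - w) * w ^ (m + 1) = t * w + 1) {z : ℂ} (hz : 1 ≤ ‖z‖) :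
    z ^ (m + 1) + t - (t + 3 - w) * ∑ i ∈ Finset.range (m + 1), z ^ i * (w : ℂ) ^ (m - i) ≠ 0 := by
  intro h
  have hw0 : 0 < w := by linarith
  have hd : 0 < t + 3 - w := by
    by_contra! hd
    nlinarith [mul_nonneg ht hw0.le, pow_pos hw0 (m + 1)]
  rw [Finset.sum_range_succ'] at h
  have hdw : (t + 3 - w) * w ^ m = t + 1 / w := by
    field_simp
    rw [← hroot]; ring
  have hdwC : ((t : ℂ) + 3 - w) * (w : ℂ) ^ m = t + 1 / w := by exact_mod_cast congrArg ((↑) : ℝ → ℂ) hdw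
  have hz' : z ^ (m + 1) = (1 / w : ℝ) + ((t + 3 - w : ℝ) : ℂ) *
      ∑ i ∈ Finset.range m, z ^ (i + 1) * (w : ℂ) ^ (m - (i + 1)) := by
    push_cast
    simp only [pow_zero, one_mul, Nat.sub_zero] at h
    linear_combination h + hdwC
  have hsum : ‖∑ i ∈ Finset.range m, z ^ (i + 1) * (w : ℂ) ^ (m - (i + 1))‖
      ≤ ‖z‖ ^ m * ∑ i ∈ Finset.range m, w ^ i := by
    rw [← Finset.sum_range_reflect, Finset.mul_sum]
    refine norm_sum_le_of_le _ fun i hi ↦ ?_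
    have hi := Finset.mem_range.1 hi
    rw [norm_mul, norm_pow, norm_pow, Complex.norm_real, Real.norm_of_nonneg hw0.le]
    have : m - (m - 1 - i + 1) = i := by omega
    rw [this]
    exact mul_le_mul_of_nonneg_right (pow_le_pow_right₀ hz (by omega)) (by positivity)
  have hgeom := geom_sum_mul w m
  set G := ∑ i ∈ Finset.range m, w ^ i
  have hzm : 1 ≤ ‖z‖ ^ m := one_le_pow₀ hz
  have hle : ‖z‖ ^ (m + 1) ≤ 1 / w + (t + 3 - w) * (‖z‖ ^ m * G) := by
    rw [← norm_pow, hz']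
    refine (norm_add_le _ _).trans ?_
    rw [norm_mul, Complex.norm_real, Complex.norm_real, Real.norm_of_nonneg hd.le,
      Real.norm_of_nonneg (by positivity)]
    gcongr
  have hdG : (t + 3 - w) * G * (w - 1) ≤ t + 1 / w := by
    rw [mul_assoc, hgeom, mul_sub, hdw]; linarith
  have hinv : (t + 2) * (1 / w) < 1 := by
    rw [mul_one_div, div_lt_one hw0]; exact hw
  have hpos : 0 < 1 / w := by positivity
  have hG : 0 ≤ (t + 3 - w) * G := by positivity
  have hdG' : (t + 3 - w) * G * (t + 1) ≤ t + 1 / w := by nlinarith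
  have hlt : 1 / w + (t + 3 - w) * G < 1 := by
    by_contra! hc
    nlinarith
  have : ‖z‖ ^ (m + 1) < ‖z‖ ^ m := by nlinarith
  rw [pow_succ] at this
  nlinarith

theorem exists_dominant_root {m : ℕ} (hm : 2 ≤ m) {t : ℝ} (ht : 0 ≤ t) :
    ∃ w : ℝ, t + 2 < w ∧ w < t + 3 ∧ (t + 3 - w) * w ^ (m + 1) = t * w + 1 := by
  have hc : ContinuousOn (fun w : ℝ ↦ (t + 3 - w) * w ^ (m + 1) - (t * w + 1))
      (Set.Icc (t + 2) (t + 3)) := by fun_prop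
  have h1 : (t + 2) ^ 3 ≤ (t + 2) ^ (m + 1) := pow_le_pow_right₀ (by linarith) (by omega)
  obtain ⟨w, ⟨h2, h3⟩, h4⟩ := intermediate_value_Ioo' (by linarith) hc
    (show (0 : ℝ) ∈ _ by
      refine ⟨?_, ?_⟩
      · simp only [sub_self, zero_mul]; nlinarith
      · have : t + 3 - (t + 2) = 1 := by ring
        simp only [this, one_mul]
        nlinarith [pow_nonneg ht 3])
  exact ⟨w, h2, h3, sub_eq_zero.1 h4⟩

theorem exists_small_root {m : ℕ} (hm : 2 ≤ m) {t : ℝ} (ht : 8 ≤ t) :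
    ∃ x : ℝ, |x| < 2 / t ∧ x ^ (m + 2) - (t + 3) * x ^ (m + 1) + t * x + 1 = 0 := by
  have ht0 : 0 < t := by linarith
  have hc : ContinuousOn (fun x : ℝ ↦ x ^ (m + 2) - (t + 3) * x ^ (m + 1) + t * x + 1)
      (Set.Icc (-(2 / t)) 0) := by fun_prop
  set e := 2 / t with he
  have he0 : 0 < e := by positivity
  have hte : t * e = 2 := by rw [he]; field_simp
  have he1 : e ≤ 1 / 4 := by nlinarith
  have h1 : e ^ (m + 1) ≤ e ^ 3 := pow_le_pow_of_le_one he0.le (by linarith) (by omega)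
  have h2 : e ^ (m + 2) ≤ e ^ 4 := pow_le_pow_of_le_one he0.le (by linarith) (by omega)
  have h1' : |(-e) ^ (m + 1)| ≤ e ^ 3 := by rwa [abs_pow, abs_neg, abs_of_pos he0]
  have h2' : |(-e) ^ (m + 2)| ≤ e ^ 4 := by rwa [abs_pow, abs_neg, abs_of_pos he0]
  have he2 : e ^ 2 ≤ 1 / 16 := by nlinarith
  have he3 : e ^ 3 ≤ 1 / 64 := by nlinarith
  have he4 : e ^ 4 ≤ 1 / 256 := by nlinarith
  have hte3 : t * e ^ 3 = 2 * e ^ 2 := by rw [← hte]; ring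
  obtain ⟨x, ⟨h3, h4⟩, h5⟩ := intermediate_value_Ioo' (by linarith : -e ≤ 0)
    (hc.comp continuousOn_id (fun _ h ↦ h) |>.neg)
    (show (0 : ℝ) ∈ _ by
      simp only [Function.comp_def, id]
      refine ⟨?_, ?_⟩
      · simp
      · simp only [Pi.neg_apply]
        nlinarith [(abs_le.1 h1').1, (abs_le.1 h2').2])
  exact ⟨x, by rw [abs_of_neg h4]; linarith, neg_eq_zero.1 h5⟩

theorem isUnit_and_isUnit_one_sub {R : Type*} [CommRing R] {m : ℕ} {t : ℤ} {a : R}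
    (h : a ^ (m + 2) - (t + 3) * a ^ (m + 1) + t * a + 1 = 0) :
    IsUnit a ∧ IsUnit (1 - a) := by
  refine ⟨isUnit_of_dvd_one ⟨-(a ^ (m + 1) - (t + 3) * a ^ m + t), by linear_combination h⟩,
    isUnit_of_dvd_one ?_⟩
  have h1 := sub_dvd_pow_sub_pow 1 a (m + 2)
  have h2 := sub_dvd_pow_sub_pow 1 a (m + 1)
  rw [one_pow] at h1 h2
  have : (1 : R) = (t + 3) * (1 - a ^ (m + 1)) - (1 - a ^ (m + 2)) - t * (1 - a) := by
    linear_combination -h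
  rw [show (1 - a ∣ 1) = (1 - a ∣ _) from congrArg _ this]
  exact dvd_sub (dvd_sub (h2.mul_left _) h1) (dvd_mul_left _ _)

/-- The polynomial `X ^ (m + 2) - (t + 3) X ^ (m + 1) + t X + 1`, which satisfies Perron's
irreducibility criterion when `t` is nonnegative. -/
noncomputable def perronTrinomial (m : ℕ) (t : ℤ) : ℤ[X] :=
  X ^ (m + 2) - (C t + 3) * X ^ (m + 1) + C t * X + 1

theorem perronTrinomial_degree_sub_lt (m : ℕ) (t : ℤ) :
    (-(C t + 3) * X ^ (m + 1) + C t * X + 1 : ℤ[X]).degree < ((m + 2 : ℕ) : WithBot ℕ) := by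
  have : (-(C t + 3) * X ^ (m + 1) + C t * X + 1 : ℤ[X]).degree ≤ ((m + 1 : ℕ) : WithBot ℕ) := by
    rw [show (-(C t + 3) : ℤ[X]) = C (-(t + 3)) by simp]
    compute_degree
    exact max_le le_rfl (by exact_mod_cast Nat.le_add_left 1 m)
  exact this.trans_lt (by exact_mod_cast Nat.lt_succ_self _)

theorem perronTrinomial_eq (m : ℕ) (t : ℤ) : perronTrinomial m t =
    X ^ (m + 2) + (-(C t + 3) * X ^ (m + 1) + C t * X + 1) := by
  rw [perronTrinomial]; ring

theorem perronTrinomial_monic (m : ℕ) (t : ℤ) : (perronTrinomial m t).Monic := by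
  rw [perronTrinomial_eq]
  exact monic_X_pow_add (perronTrinomial_degree_sub_lt m t)

theorem perronTrinomial_natDegree (m : ℕ) (t : ℤ) : (perronTrinomial m t).natDegree = m + 2 := by
  rw [perronTrinomial_eq]
  exact natDegree_eq_of_degree_eq_some
    ((degree_add_eq_left_of_degree_lt (by
      simpa using perronTrinomial_degree_sub_lt m t)).trans (degree_X_pow _))

theorem aeval_perronTrinomial {R : Type*} [CommRing R] (m : ℕ) (t : ℤ) (a : R) :
    aeval a (perronTrinomial m t) =
      a ^ (m + 2) - (t + 3) * a ^ (m + 1) + t * a + 1 := by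
  simp [perronTrinomial, map_ofNat]

theorem map_perronTrinomial_eq_mul {m : ℕ} {t : ℤ} {w : ℝ}
    (hroot : (t + 3 - w) * w ^ (m + 1) = t * w + 1) :
    (perronTrinomial m t).map (Int.castRingHom ℂ) = (X - C (w : ℂ)) *
      (X ^ (m + 1) + C (t : ℂ) - C ((t : ℂ) + 3 - w) *
        ∑ i ∈ Finset.range (m + 1), X ^ i * C (w : ℂ) ^ (m - i)) := by
  have h := (Commute.all (X : ℂ[X]) (C (w : ℂ))).geom_sum₂_mul (m + 1)
  simp only [Nat.add_sub_cancel] at h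
  have hC : C (((t : ℂ) + 3 - w) * w ^ (m + 1)) = C ((t : ℂ) * w + 1) :=
    congrArg C (by exact_mod_cast congrArg ((↑) : ℝ → ℂ) hroot)
  have hmap : (perronTrinomial m t).map (Int.castRingHom ℂ) =
      X ^ (m + 2) - (C (t : ℂ) + C 3) * X ^ (m + 1) + C (t : ℂ) * X + 1 := by
    simp [perronTrinomial, -eq_intCast, -map_intCast, ← map_ofNat (C : ℂ →+* ℂ[X]) 3]
  rw [hmap]
  simp only [C_mul, C_add, C_sub, C_pow, C_1] at hC h ⊢
  linear_combination (C (t : ℂ) + C 3 - C (w : ℂ)) * h - hC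

theorem norm_multiset_prod_lt_one {s : Multiset ℂ} (hs : s ≠ 0) (h : ∀ z ∈ s, ‖z‖ < 1) :
    ‖s.prod‖ < 1 := by
  induction s using Multiset.induction_on with
  | empty => exact absurd rfl hs
  | cons a s ih =>
    rw [Multiset.prod_cons, norm_mul]
    have ha := h a (Multiset.mem_cons_self a s)
    rcases eq_or_ne s 0 with rfl | hs0
    · simpa using ha
    · exact mul_lt_one_of_nonneg_of_lt_one_left (norm_nonneg _) ha
        (ih hs0 fun z hz ↦ h z (Multiset.mem_cons_of_mem hz)).le

theorem exists_root_one_le_norm {f : ℤ[X]} (hf : f.Monic) (hdeg : f.natDegree ≠ 0)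
    (h0 : f.coeff 0 ≠ 0) : ∃ z : ℂ, aeval z f = 0 ∧ 1 ≤ ‖z‖ := by
  by_contra! h
  have hs := IsAlgClosed.splits (f.map (Int.castRingHom ℂ))
  have hm := hf.map (Int.castRingHom ℂ)
  have hprod := congrArg norm (hs.coeff_zero_eq_prod_roots_of_monic hm)
  have hlt : ‖(f.map (Int.castRingHom ℂ)).roots.prod‖ < 1 := by
    refine norm_multiset_prod_lt_one (fun h0 ↦ hdeg ?_) fun z hz ↦ h z ?_
    · rw [← hf.natDegree_map (Int.castRingHom ℂ), hs.natDegree_eq_card_roots, h0,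
        Multiset.card_zero]
    · have := (mem_roots'.1 hz).2
      rwa [IsRoot, eval_map, ← algebraMap_int_eq, ← aeval_def] at this
  rw [norm_mul, norm_pow, norm_neg, norm_one, one_pow, one_mul, coeff_map, eq_intCast,
    Complex.norm_intCast] at hprod
  rw [← hprod] at hlt
  exact h0 (Int.abs_lt_one_iff.1 (by exact_mod_cast hlt))

theorem norm_lt_one_of_ne_dominant_root {m : ℕ} {t : ℤ} (ht : 0 ≤ t) {w : ℝ} (hw : t + 2 < w)
    (hroot : (t + 3 - w) * w ^ (m + 1) = t * w + 1) {z : ℂ}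
    (hz : aeval z (perronTrinomial m t) = 0) (hne : z ≠ w) : ‖z‖ < 1 := by
  by_contra! h
  have hfac := congrArg (eval z) (map_perronTrinomial_eq_mul hroot)
  rw [eval_map, ← algebraMap_int_eq, ← aeval_def, hz, eval_mul, eq_comm, mul_eq_zero] at hfac
  rcases hfac with hfac | hfac
  · exact hne (sub_eq_zero.1 (by simpa using hfac))
  · exact cofactor_ne_zero (by exact_mod_cast ht) hw hroot h
      (by simpa [eval_finsetSum] using hfac)

theorem irreducible_perronTrinomial {m : ℕ} (hm : 2 ≤ m) {t : ℤ} (ht : 0 ≤ t) :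
    Irreducible (perronTrinomial m t) := by
  obtain ⟨w, hw, -, hroot⟩ := exists_dominant_root hm (t := t) (by exact_mod_cast ht)
  have hfac := map_perronTrinomial_eq_mul hroot
  rw [(perronTrinomial_monic m t).irreducible_iff_natDegree]
  refine ⟨fun h ↦ by simpa [h] using perronTrinomial_natDegree m t, fun f g hf hg hfg ↦ ?_⟩
  have hdvd : ∀ p : ℤ[X], p.Monic → p ∣ perronTrinomial m t → p.natDegree ≠ 0 →
      X - C (w : ℂ) ∣ p.map (Int.castRingHom ℂ) := by
    rintro p hp ⟨q, hq⟩ hpd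
    obtain ⟨z, hz, hz1⟩ := exists_root_one_le_norm hp hpd fun h0 ↦ by
      have := congrArg (fun r ↦ coeff r 0) hq
      simp [mul_coeff_zero, h0, perronTrinomial] at this
    have hzw : z = w := by
      by_contra hne
      refine (norm_lt_one_of_ne_dominant_root ht hw hroot ?_ hne).not_ge hz1
      rw [hq, map_mul, hz, zero_mul]
    rwa [dvd_iff_isRoot, IsRoot, eval_map, ← algebraMap_int_eq, ← aeval_def, ← hzw]
  by_contra! hdeg
  obtain ⟨a, ha⟩ := hdvd f hf ⟨g, hfg.symm⟩ hdeg.1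
  obtain ⟨b, hb⟩ := hdvd g hg ⟨f, by rw [← hfg, mul_comm]⟩ hdeg.2
  rw [← hfg, Polynomial.map_mul, ha, hb, mul_assoc] at hfac
  have hcof := congrArg (eval (w : ℂ)) (mul_left_cancel₀ (X_sub_C_ne_zero _) hfac)
  refine cofactor_ne_zero (m := m) (z := w) (by exact_mod_cast ht) hw hroot ?_ ?_
  · have : (0 : ℝ) ≤ t := by exact_mod_cast ht
    rw [Complex.norm_real, Real.norm_of_nonneg] <;> linarith
  · simpa [eval_finsetSum] using hcof.symm

theorem minpoly_of_aeval_perronTrinomial {K : Type*} [Field K] [Algebra ℚ K] {m : ℕ}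
    (hm : 2 ≤ m) {t : ℤ} (ht : 0 ≤ t) {a : K} (ha : aeval a (perronTrinomial m t) = 0) :
    minpoly ℚ a = (perronTrinomial m t).map (algebraMap ℤ ℚ) := by
  have hmonic := perronTrinomial_monic m t
  refine (minpoly.eq_of_irreducible_of_monic
    ((hmonic.irreducible_iff_irreducible_map_fraction_map (K := ℚ)).1
      (irreducible_perronTrinomial hm ht)) ?_ (hmonic.map _)).symm
  rwa [aeval_map_algebraMap]

theorem finrank_adjoin_of_aeval_perronTrinomial {K : Type*} [Field K] [Algebra ℚ K] {m : ℕ}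
    (hm : 2 ≤ m) {t : ℤ} (ht : 0 ≤ t) {a : K} (ha : aeval a (perronTrinomial m t) = 0) :
    Module.finrank ℚ (IntermediateField.adjoin ℚ {a}) = m + 2 := by
  have hmin := minpoly_of_aeval_perronTrinomial hm ht ha
  have hint : IsIntegral ℚ a := IsIntegral.tower_top ⟨_, perronTrinomial_monic m t, ha⟩
  rw [IntermediateField.adjoin.finrank hint, hmin, (perronTrinomial_monic m t).natDegree_map,
    perronTrinomial_natDegree]

theorem exists_units_of_aeval_perronTrinomial {K : Type*} [Field K] {m : ℕ} {t : ℤ} {a : K}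
    (ha : aeval a (perronTrinomial m t) = 0) :
    ∃ u v : (integralClosure ℤ K)ˣ, ((u : integralClosure ℤ K) : K) = a ∧
      ((v : integralClosure ℤ K) : K) = 1 - a := by
  let b : integralClosure ℤ K := ⟨a, _, perronTrinomial_monic m t, ha⟩
  have hb : aeval b (perronTrinomial m t) = 0 :=
    Subtype.ext ((aeval_algebraMap_apply K b _).symm.trans ha)
  rw [aeval_perronTrinomial] at hb
  obtain ⟨⟨u, hu⟩, ⟨v, hv⟩⟩ := isUnit_and_isUnit_one_sub hb
  exact ⟨u, v, by rw [hu], by rw [hv]; rfl⟩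

theorem exists_field_with_embeddings {m : ℕ} (hm : 2 ≤ m) {t : ℤ} (ht : 8 ≤ t) :
    ∃ F : IntermediateField ℚ ℂ, Module.finrank ℚ F = m + 2 ∧
      ∃ (σ : F →+* ℂ) (a : F) (w : ℝ), aeval a (perronTrinomial m t) = 0 ∧ (a : ℂ) = w ∧
        t + 2 < w ∧ w < t + 3 ∧ ‖σ a‖ < 2 / t ∧ ∀ τ : F →+* ℂ, τ ≠ algebraMap F ℂ → ‖τ a‖ < 1 := by
  have ht0 : 0 ≤ t := by omega
  obtain ⟨w, hw, hw', hroot⟩ := exists_dominant_root hm (t := t) (by exact_mod_cast ht0)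
  obtain ⟨x, hx, hx'⟩ := exists_small_root hm (t := t) (by exact_mod_cast ht)
  have hwroot : aeval (w : ℂ) (perronTrinomial m t) = 0 := by
    rw [aeval_perronTrinomial]
    have : w ^ (m + 2) - (t + 3) * w ^ (m + 1) + t * w + 1 = 0 := by linear_combination -hroot
    exact_mod_cast congrArg ((↑) : ℝ → ℂ) this
  have hxroot : aeval (x : ℂ) (perronTrinomial m t) = 0 := by
    rw [aeval_perronTrinomial]
    exact_mod_cast congrArg ((↑) : ℝ → ℂ) hx'
  have hint : IsIntegral ℚ (w : ℂ) :=
    IsIntegral.tower_top ⟨_, perronTrinomial_monic m t, hwroot⟩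
  let pb := IntermediateField.adjoin.powerBasis hint
  have hgen : pb.gen = IntermediateField.AdjoinSimple.gen ℚ (w : ℂ) :=
    IntermediateField.adjoin.powerBasis_gen hint
  have hgenw : ((pb.gen : IntermediateField.adjoin ℚ {(w : ℂ)}) : ℂ) = w := by rw [hgen]; rfl
  have hgenroot : aeval pb.gen (perronTrinomial m t) = 0 :=
    Subtype.ext (((aeval_algebraMap_apply ℂ pb.gen _).symm.trans
      (congrArg (aeval · _) hgenw)).trans hwroot)
  refine ⟨_, finrank_adjoin_of_aeval_perronTrinomial hm ht0 hwroot,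
    (pb.lift (x : ℂ) ?_).toRingHom, pb.gen, w, hgenroot, hgenw, hw, hw', ?_, fun τ hτ ↦ ?_⟩
  · refine (congrArg (aeval (x : ℂ)) (minpoly_of_aeval_perronTrinomial hm ht0 hgenroot)).trans ?_
    rw [aeval_map_algebraMap, hxroot]
  · refine ((congrArg norm (pb.lift_gen (x : ℂ) _)).trans (Complex.norm_real x)).trans_lt hx
  · refine norm_lt_one_of_ne_dominant_root ht0 hw hroot ?_
      fun h ↦ hτ (congrArg AlgHom.toRingHom
        (pb.algHom_ext (f := τ.toRatAlgHom) (g := IntermediateField.val _)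
          (h.trans hgenw.symm)))
    have := aeval_algHom_apply τ.toIntAlgHom pb.gen (perronTrinomial m t)
    rw [hgenroot, map_zero] at this
    exact this

theorem one_le_prod_norm_embeddings {F : Type*} [Field F] [NumberField F] {x : F}
    (hx : IsIntegral ℤ x) (h0 : x ≠ 0) : 1 ≤ ∏ τ : F →+* ℂ, ‖τ x‖ := by
  rw [Fintype.prod_equiv (RingHom.equivRatAlgHom F ℂ) (fun τ : F →+* ℂ ↦ ‖τ x‖)
    (fun τ : F →ₐ[ℚ] ℂ ↦ ‖τ x‖) fun _ ↦ rfl, ← norm_prod, ← Algebra.norm_eq_prod_embeddings ℚ ℂ x]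
  obtain ⟨k, hk⟩ := IsIntegrallyClosed.isIntegral_iff.1 (Algebra.isIntegral_norm ℚ hx)
  rw [← hk]
  have : k ≠ 0 := by
    rintro rfl
    rw [map_zero, eq_comm, Algebra.norm_eq_zero_iff] at hk
    exact h0 hk
  simpa using (by exact_mod_cast Int.one_le_abs this : (1 : ℝ) ≤ |(k : ℝ)|)

/-- If there were finitely many fields, then two parameters at bounded distance would give roots
`a`, `b` of the same field whose difference has norm less than one. -/
theorem infinite_exceptional_fields {m : ℕ} (hm : 2 ≤ m) :
    {F : IntermediateField ℚ ℂ | Module.finrank ℚ F = m + 2 ∧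
      ∃ u v : (integralClosure ℤ F)ˣ,
        ((v : integralClosure ℤ F) : F) = 1 - ((u : integralClosure ℤ F) : F)}.Infinite := by
  intro hfin
  set S := {F : IntermediateField ℚ ℂ | Module.finrank ℚ F = m + 2 ∧
      ∃ u v : (integralClosure ℤ F)ˣ,
        ((v : integralClosure ℤ F) : F) = 1 - ((u : integralClosure ℤ F) : F)} 
  have hnf : ∀ F : S, NumberField F.1 := fun F ↦
    have : FiniteDimensional ℚ F.1 := Module.finite_of_finrank_pos (by have := F.2.1; omega)
    { }
  have := hfin.to_subtype
  let A := (F : S) × (F.1 →+* ℂ)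
  let κ : ℕ := Nat.card A + 2
  let P : A → ℤ → Prop := fun p t ↦ ∃ (a : p.1.1) (w : ℝ),
    aeval a (perronTrinomial m t) = 0 ∧ (a : ℂ) = w ∧ t + 2 < w ∧ w < t + 3 ∧
      ‖p.2 a‖ < 2 / t ∧ ∀ τ : p.1.1 →+* ℂ, τ ≠ algebraMap p.1.1 ℂ → ‖τ a‖ < 1
  have hP : ∀ t : ℤ, 8 ≤ t → ∃ p, P p t := fun t ht ↦ by
    obtain ⟨F, hF, σ, a, w, ha, h⟩ := exists_field_with_embeddings hm ht
    obtain ⟨u, v, hu, hv⟩ := exists_units_of_aeval_perronTrinomial ha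
    exact ⟨⟨⟨F, hF, u, v, by rw [hu, hv]⟩, σ⟩, a, w, ha, h⟩
  have : Nonempty A := (hP 8 le_rfl).nonempty
  let T : ℕ := κ * 4 * 2 ^ m + 8
  choose! p hp using hP
  obtain ⟨i, j, hij, hpij⟩ : ∃ i j : Fin (Nat.card A + 1), i ≠ j ∧ p (T + i) = p (T + j) := by
    have := Fintype.ofFinite A
    exact Fintype.exists_ne_map_eq_of_card_lt (fun i : Fin (Nat.card A + 1) ↦ p (T + i))
      (by rw [Fintype.card_fin, Nat.card_eq_fintype_card]; omega)
  obtain ⟨a, w, ha, haw, hw1, hw2, hσa, hτa⟩ := hp (T + i) (by omega)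
  have hpj := hp (T + j) (by omega)
  rw [← hpij] at hpj
  obtain ⟨b, v, hb, hbv, hv1, hv2, hσb, hτb⟩ := hpj
  generalize p (T + i) = q at *
  obtain ⟨⟨F, hF⟩, σ⟩ := q
  dsimp only at *
  have : NumberField F := hnf ⟨F, hF⟩
  push_cast at *
  have hT : (8 : ℝ) ≤ T := by exact_mod_cast Nat.le_add_left _ _
  have hi : ((i : ℕ) : ℝ) + 1 ≤ κ - 1 := by
    have : (i : ℕ) + 1 + 1 ≤ κ := by omega
    have : ((i : ℕ) : ℝ) + 1 + 1 ≤ κ := by exact_mod_cast this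
    linarith
  have hj : ((j : ℕ) : ℝ) + 1 ≤ κ - 1 := by
    have : (j : ℕ) + 1 + 1 ≤ κ := by omega
    have : ((j : ℕ) : ℝ) + 1 + 1 ≤ κ := by exact_mod_cast this
    linarith
  have hi0 : (0 : ℝ) ≤ (i : ℕ) := Nat.cast_nonneg _
  have hj0 : (0 : ℝ) ≤ (j : ℕ) := Nat.cast_nonneg _
  have hab : a - b ≠ 0 := by
    intro h
    have hwv : w = v := by
      have := congrArg (fun x : F ↦ (x : ℂ)) (sub_eq_zero.1 h)
      simp only [haw, hbv] at this
      exact_mod_cast this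
    have h1 : ((i : ℕ) : ℝ) < (j : ℕ) + 1 := by linarith
    have h2 : ((j : ℕ) : ℝ) < (i : ℕ) + 1 := by linarith
    norm_cast at h1 h2
    exact hij (Fin.ext (by omega))
  have hint : IsIntegral ℤ (a - b) :=
    IsIntegral.sub ⟨_, perronTrinomial_monic _ _, ha⟩ ⟨_, perronTrinomial_monic _ _, hb⟩
  have hge := one_le_prod_norm_embeddings hint hab
  have hval : ‖(algebraMap F ℂ) (a - b)‖ ≤ κ := by
    rw [map_sub, IntermediateField.algebraMap_apply, IntermediateField.algebraMap_apply, haw, hbv,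
      ← Complex.ofReal_sub, Complex.norm_real, Real.norm_eq_abs, abs_le]
    constructor <;> linarith
  have hσab : ‖σ (a - b)‖ ≤ 4 / T := by
    rw [map_sub]
    have h1 : 2 / ((T : ℝ) + (i : ℕ)) ≤ 2 / T := by gcongr; linarith
    have h2 : 2 / ((T : ℝ) + (j : ℕ)) ≤ 2 / T := by gcongr; linarith
    have h3 : (4 : ℝ) / T = 2 / T + 2 / T := by ring
    linarith [norm_sub_le (σ a) (σ b)]
  have hσval : σ ≠ (algebraMap F ℂ) := by
    rintro rfl
    rw [IntermediateField.algebraMap_apply, haw, Complex.norm_real, Real.norm_eq_abs] at hσa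
    have : 2 / ((T : ℝ) + (i : ℕ)) ≤ 2 := div_le_self (by norm_num) (by linarith)
    linarith [le_abs_self w]
  classical
  have hcard : ((Finset.univ.erase (algebraMap F ℂ)).erase σ).card = m := by
    rw [Finset.card_erase_of_mem (by simpa using hσval), Finset.card_erase_of_mem (by simp),
      Finset.card_univ, Embeddings.card, hF.1]
    rfl
  have hrest : ∏ τ ∈ (Finset.univ.erase (algebraMap F ℂ)).erase σ, ‖τ (a - b)‖ ≤ 2 ^ m := by
    rw [← hcard, ← Finset.prod_const]
    refine Finset.prod_le_prod (fun _ _ ↦ norm_nonneg _) fun τ hτ ↦ ?_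
    have hτ := Finset.ne_of_mem_erase (Finset.mem_of_mem_erase hτ)
    rw [map_sub]
    linarith [norm_sub_le (τ a) (τ b), hτa τ hτ, hτb τ hτ]
  rw [← Finset.mul_prod_erase _ _ (Finset.mem_univ (algebraMap F ℂ)),
    ← Finset.mul_prod_erase _ _ (Finset.mem_erase.2 ⟨hσval, Finset.mem_univ σ⟩)] at hge
  have hle : (1 : ℝ) ≤ κ * (4 / T * 2 ^ m) := hge.trans (by gcongr)
  have hTeq : (T : ℝ) = κ * 4 * 2 ^ m + 8 := by simp [T]
  have : (κ : ℝ) * (4 / T * 2 ^ m) = (κ * 4 * 2 ^ m) / T := by ring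
  rw [this, one_le_div (by linarith)] at hle
  linarith

/-- For all integers `n ≥ 4` and `t ≥ 4`, any root `α` of
`g_n(x;t) = xⁿ − (t+3)·x^{n−1} + t·x + 1` is an exceptional unit of the
degree-`n` number field `ℚ(α)`: both `α` and `1 − α` are units in the ring of
integers of `ℚ(α)`.  Hence for every `n ≥ 4` there exist infinitely many
exceptional number fields of degree `n` (realized as subfields of `ℂ`). -/
theorem stmt_15 :
    (∀ (n : ℕ), 4 ≤ n → ∀ (t : ℤ), 4 ≤ t →
      ∀ (K : Type) [Field K] [NumberField K] (α : K),
        Polynomial.aeval α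
          (X ^ n - C ((t : ℚ) + 3) * X ^ (n - 1) + C (t : ℚ) * X + 1 : Polynomial ℚ) = 0 →
        IntermediateField.adjoin ℚ {α} = ⊤ →
        (Module.finrank ℚ K = n ∧
          (∃ u : (𝓞 K)ˣ, ((u : 𝓞 K) : K) = α) ∧
          (∃ v : (𝓞 K)ˣ, ((v : 𝓞 K) : K) = 1 - α))) ∧
    (∀ (n : ℕ), 4 ≤ n →
      {F : IntermediateField ℚ ℂ | Module.finrank ℚ F = n ∧
        ∃ u v : (integralClosure ℤ F)ˣ,
          ((v : integralClosure ℤ F) : F) = 1 - ((u : integralClosure ℤ F) : F)}.Infinite) := by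
  refine ⟨fun n hn t ht K _ _ α hα htop ↦ ?_, fun n hn ↦ ?_⟩
  · obtain ⟨m, rfl⟩ := Nat.exists_eq_add_of_le' (by omega : 2 ≤ n)
    have hroot : aeval α (perronTrinomial m t) = 0 := by
      rw [aeval_perronTrinomial, ← hα]
      simp [map_ofNat]
    obtain ⟨u, v, hu, hv⟩ := exists_units_of_aeval_perronTrinomial hroot
    refine ⟨?_, ⟨u, hu⟩, v, hv⟩
    rw [← finrank_adjoin_of_aeval_perronTrinomial (by omega : 2 ≤ m) (by omega) hroot, htop,
      IntermediateField.finrank_top']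
  · obtain ⟨m, rfl⟩ := Nat.exists_eq_add_of_le' (by omega : 2 ≤ n)
    exact infinite_exceptional_fields (by omega)
end
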